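/- Assume the Bethe ansatz equations (BAE)_ν hold for all 1 ≤ ν ≤ n−1 and all roots of y_ν. Then for every root s^{(0)}_a of y_0 (1 ≤ a ≤ l_0), the points q_3^{−1} q_2^{−j} s^{(0)}_a for 1 ≤ j ≤ n, and the points q_3^{n−1} q_2^{−j} s^{(0)}_a for j = 0, 1, are apparent singularities of the companion system Y(q_2 x) = A(x) Y(x), where A(x) is the n×n companion matrix with first row (t_1(x), −t_2(x), …, (−1)^{n−1} t_n(x)), subdiagonal entries 1, and zeros elsewhere; that is, A(q_2^N x) A(q_2^{N−1}x) ⋯ A(q_2^{−N'}x) is holomorphic and invertible at each of these points for all sufficiently large N, N' ∈ ℤ_{≥0}. -/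

import Mathlib

open Polynomial Finset
open scoped Classical

noncomputable section

/-- The rational function `x ↦ p (c * x)` associated with a polynomial `p`. -/
def pshift (c : ℂ) (p : Polynomial ℂ) : RatFunc ℂ :=
  algebraMap (Polynomial ℂ) (RatFunc ℂ) (p.comp (C c * X))

/-- The rational function `x ↦ f (c * x)`. -/
def qshift (c : ℂ) (f : RatFunc ℂ) : RatFunc ℂ :=
  algebraMap (Polynomial ℂ) (RatFunc ℂ) (f.num.comp (C c * X)) /
    algebraMap (Polynomial ℂ) (RatFunc ℂ) (f.denom.comp (C c * X))

/-- `y_ν(x) = ∏_i (x − s^{(ν)}_i)`. -/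
def yP (n : ℕ) (l : ZMod n → ℕ) (s : (ν : ZMod n) → Fin (l ν) → ℂ) (ν : ZMod n) :
    Polynomial ℂ :=
  ∏ i : Fin (l ν), (X - C (s ν i))

/-- `Ψ̃_ν(c x) = G_ν(c x)/F_ν(c x)` as a rational function. -/
def psiR (n : ℕ) (F G : ZMod n → Polynomial ℂ) (ν : ZMod n) (c : ℂ) : RatFunc ℂ :=
  pshift c (G ν) / pshift c (F ν)

/-- The rational functions `b_i(x)`, `1 ≤ i ≤ n` (indices of `y` taken mod `n`). -/
def bf (n : ℕ) (q1 q2 q3 : ℂ) (l : ZMod n → ℕ) (s : (ν : ZMod n) → Fin (l ν) → ℂ)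
    (F G : ZMod n → Polynomial ℂ) (i : ℕ) : RatFunc ℂ :=
  if i = 1 then
    pshift q2 (yP n l s 1) / algebraMap (Polynomial ℂ) (RatFunc ℂ) (yP n l s 1)
  else
    (∏ ν ∈ Finset.Icc 1 (i - 1), psiR n F G (ν : ZMod n) (q1 ^ (ν - 1) * q2 ^ (i - 1)))
      * (pshift (q3 ^ ((2 : ℤ) - (i : ℤ))) (yP n l s ((i : ZMod n) - 1)) /
          pshift (q3 ^ ((2 : ℤ) - (i : ℤ)) * q2) (yP n l s ((i : ZMod n) - 1)))
      * (pshift (q3 ^ ((1 : ℤ) - (i : ℤ)) * q2) (yP n l s (i : ZMod n)) /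
          pshift (q3 ^ ((1 : ℤ) - (i : ℤ))) (yP n l s (i : ZMod n)))
      * (pshift (q3 * q2 ^ i) (yP n l s 0) / pshift (q3 * q2 ^ (i - 1)) (yP n l s 0))

/-- `t_k(x) = ∑_{1≤i_1<⋯<i_k≤n} ∏_p b_{i_p}(q_2^{n−i_p−k+p} x)`. -/
def tf (n : ℕ) (q1 q2 q3 : ℂ) (l : ZMod n → ℕ) (s : (ν : ZMod n) → Fin (l ν) → ℂ)
    (F G : ZMod n → Polynomial ℂ) (k : ℕ) : RatFunc ℂ :=
  ∑ v ∈ Finset.univ.filter (fun v : Fin k → Fin n => StrictMono v),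
    ∏ p : Fin k,
      qshift (q2 ^ ((n : ℤ) - (((v p : ℕ) : ℤ) + 1) - (k : ℤ) + (((p : ℕ) : ℤ) + 1)))
        (bf n q1 q2 q3 l s F G ((v p : ℕ) + 1))

/-- The leading coefficient
`a_0(x) = ∏_{1≤ν<i≤n} F_ν(q_1^{ν−1}q_2^{i−1}x) · ∏_{j=1}^{n−1} y_0(q_3 q_2^j x) · y_0(q_3^{1−n} x)`. -/
def a0R (n : ℕ) (q1 q2 q3 : ℂ) (l : ZMod n → ℕ) (s : (ν : ZMod n) → Fin (l ν) → ℂ)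
    (F : ZMod n → Polynomial ℂ) : RatFunc ℂ :=
  (∏ p ∈ ((Finset.Icc 1 n) ×ˢ (Finset.Icc 1 n)).filter (fun p => p.1 < p.2),
      pshift (q1 ^ (p.1 - 1) * q2 ^ (p.2 - 1)) (F (p.1 : ZMod n)))
    * (∏ j ∈ Finset.Icc 1 (n - 1), pshift (q3 * q2 ^ j) (yP n l s 0))
    * pshift (q3 ^ ((1 : ℤ) - (n : ℤ))) (yP n l s 0)

/-- `a_k(x) = a_0(x) t_k(x)`. -/
def aR (n : ℕ) (q1 q2 q3 : ℂ) (l : ZMod n → ℕ) (s : (ν : ZMod n) → Fin (l ν) → ℂ)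
    (F G : ZMod n → Polynomial ℂ) (k : ℕ) : RatFunc ℂ :=
  a0R n q1 q2 q3 l s F * tf n q1 q2 q3 l s F G k

/-- The Bethe ansatz equation (BAE)_ν at the point `z`. -/
def BAE (n : ℕ) (q1 q2 q3 : ℂ) (l : ZMod n → ℕ) (s : (ν : ZMod n) → Fin (l ν) → ℂ)
    (F G : ZMod n → Polynomial ℂ) (ν : ZMod n) (z : ℂ) : Prop :=
  ((yP n l s ν).eval (q2 * z) / (yP n l s ν).eval (q2⁻¹ * z))
    * ((yP n l s (ν - 1)).eval (q3 * z) / (yP n l s (ν - 1)).eval (q1⁻¹ * z))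
    * ((yP n l s (ν + 1)).eval (q1 * z) / (yP n l s (ν + 1)).eval (q3⁻¹ * z))
  = -((G ν).eval z / (F ν).eval z)


/-- The `n × n` companion matrix `A(x)` with first row
`(t_1(x), −t_2(x), …, (−1)^{n−1} t_n(x))`, subdiagonal entries `1`, zeros elsewhere. -/
def compA (n : ℕ) (q1 q2 q3 : ℂ) (l : ZMod n → ℕ) (s : (ν : ZMod n) → Fin (l ν) → ℂ)
    (F G : ZMod n → Polynomial ℂ) : Matrix (Fin n) (Fin n) (RatFunc ℂ) :=
  Matrix.of fun i j =>
    if (i : ℕ) = 0 then (-1 : RatFunc ℂ) ^ (j : ℕ) * tf n q1 q2 q3 l s F G ((j : ℕ) + 1)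
    else if (i : ℕ) = (j : ℕ) + 1 then 1 else 0

/-- A matrix of rational functions is *regular* at `s` if all its entries are
holomorphic at `s` and the value matrix at `s` is invertible. -/
def RegularAt {n : ℕ} (M : Matrix (Fin n) (Fin n) (RatFunc ℂ)) (z : ℂ) : Prop :=
  (∀ i j, (M i j).denom.eval z ≠ 0) ∧
    (Matrix.of fun i j => RatFunc.eval (RingHom.id ℂ) z (M i j)).det ≠ 0

/-- `z` is an apparent singularity of the system `Y(q x) = A(x) Y(x)`. -/
def IsApparent {n : ℕ} (q : ℂ) (A : Matrix (Fin n) (Fin n) (RatFunc ℂ)) (z : ℂ) : Prop :=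
  ∃ N0 : ℕ, ∀ N N' : ℕ, N0 ≤ N → N0 ≤ N' →
    RegularAt (((List.range (N + N' + 1)).map fun k =>
      A.map (qshift (q ^ ((N : ℤ) - (k : ℤ))))).prod) z

section Ladder

variable {K : Type*} [Field K]

/-- The coefficient of `T ^ (N - j)`, up to the sign `(-1) ^ j`, in the product
`(T - b_{N-1}) ⋯ (T - b_0)`, where `T` shifts the integer argument by one. -/
def ladderCoeff (b : ℕ → ℤ → K) (N j : ℕ) (k : ℤ) : K :=
  ∑ v ∈ Finset.univ.filter (fun v : Fin j → Fin N => StrictMono v),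
    ∏ p : Fin j, b (v p) (k + ((N : ℤ) - (((v p : ℕ) : ℤ) + 1) - (j : ℤ) + (((p : ℕ) : ℤ) + 1)))

lemma ladderCoeff_zero (b : ℕ → ℤ → K) (N : ℕ) (k : ℤ) : ladderCoeff b N 0 k = 1 := by
  have h : (Finset.univ.filter (fun v : Fin 0 → Fin N => StrictMono v)) = Finset.univ :=
    Finset.filter_true_of_mem fun v _ i => i.elim0
  rw [ladderCoeff, h]
  simp

lemma ladderCoeff_of_lt (b : ℕ → ℤ → K) {N j : ℕ} (h : N < j) (k : ℤ) :
    ladderCoeff b N j k = 0 := by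
  rw [ladderCoeff, Finset.filter_false_of_mem, Finset.sum_empty]
  intro v _ hv
  have := Fintype.card_le_of_injective v hv.injective
  simp at this
  omega

lemma ladderCoeff_succ_succ (b : ℕ → ℤ → K) (N j : ℕ) (k : ℤ) :
    ladderCoeff b (N + 1) (j + 1) k =
      ladderCoeff b N (j + 1) (k + 1) + b N k * ladderCoeff b N j k := by
  rw [ladderCoeff, ← Finset.sum_filter_add_sum_filter_not _ (fun v => v (Fin.last j) ≠ Fin.last N)]
  congr 1
  · symm
    refine Finset.sum_bij (fun v _ p => (v p).castSucc) ?_ ?_ ?_ ?_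
    · intro v hv
      simp only [Finset.mem_filter, Finset.mem_univ, true_and] at hv ⊢
      exact ⟨fun p q hpq => by simpa using hv hpq, (Fin.castSucc_lt_last _).ne⟩
    · intro v _ w _ h
      funext p
      simpa using congrFun h p
    · intro w hw
      simp only [Finset.mem_filter, Finset.mem_univ, true_and] at hw
      have hlt : ∀ p, w p ≠ Fin.last N := fun p =>
        ((hw.1.monotone (Fin.le_last p)).trans_lt (Fin.lt_last_iff_ne_last.2 hw.2)).ne
      refine ⟨fun p => (w p).castPred (hlt p), ?_, ?_⟩
      · simp only [Finset.mem_filter, Finset.mem_univ, true_and]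
        exact fun p q hpq => by simpa using hw.1 hpq
      · funext p
        simp
    · intro v _
      refine Finset.prod_congr rfl fun p _ => ?_
      simp only [Fin.val_castSucc]
      congr 1
      push_cast
      ring
  · rw [ladderCoeff, Finset.mul_sum]
    symm
    refine Finset.sum_bij (fun v _ => Fin.snoc (α := fun _ => Fin (N + 1))
      (fun p => (v p).castSucc) (Fin.last N)) ?_ ?_ ?_ ?_
    · intro v hv
      simp only [Finset.mem_filter, Finset.mem_univ, true_and] at hv ⊢
      refine ⟨?_, by simp⟩
      intro p q hpq
      induction q using Fin.lastCases with
      | last =>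
        obtain ⟨p, rfl⟩ := Fin.exists_castSucc_eq.2 hpq.ne
        simp [Fin.castSucc_lt_last]
      | cast q =>
        obtain ⟨p, rfl⟩ := Fin.exists_castSucc_eq.2 (hpq.trans (Fin.castSucc_lt_last q)).ne
        simpa using hv (by simpa using hpq)
    · intro v _ w _ h
      funext p
      simpa using congrFun h p.castSucc
    · intro w hw
      simp only [Finset.mem_filter, Finset.mem_univ, true_and, not_not] at hw
      have hlt : ∀ p : Fin j, w p.castSucc ≠ Fin.last N := fun p => by
        rw [← hw.2]
        exact (hw.1 (Fin.castSucc_lt_last p)).ne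
      refine ⟨fun p => (w p.castSucc).castPred (hlt p), ?_, ?_⟩
      · simp only [Finset.mem_filter, Finset.mem_univ, true_and]
        exact fun p q hpq => by simpa using hw.1 (by simpa using hpq)
      · funext p
        induction p using Fin.lastCases with
        | last => simp [hw.2]
        | cast p => simp
    · intro v _
      rw [Fin.prod_univ_castSucc, mul_comm]
      congr 1
      · refine Finset.prod_congr rfl fun p _ => ?_
        simp only [Fin.snoc_castSucc, Fin.val_castSucc]
        congr 1
        push_cast
        ring
      · simp

/-- The value of `(T - b_{i-1}) ⋯ (T - b_0)` on the sequence `η` placed at position `k`. -/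
def ladder (b : ℕ → ℤ → K) : ℕ → ℤ → (ℕ → K) → K
  | 0, _, η => η 0
  | i + 1, k, η => ladder b i (k + 1) (fun j => η (j + 1)) - b i k * ladder b i k η

lemma ladder_eq_sum (b : ℕ → ℤ → K) (i : ℕ) (k : ℤ) (η : ℕ → K) :
    ladder b i k η = ∑ j ∈ Finset.range (i + 1), (-1) ^ j * ladderCoeff b i j k * η (i - j) := by
  induction i generalizing k η with
  | zero => simp [ladder, ladderCoeff_zero]
  | succ i ih =>
    rw [ladder, ih, ih, Finset.sum_range_succ' _ (i + 1), Finset.sum_range_succ' _ i]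
    have h : ∑ j ∈ Finset.range i, (-1) ^ (j + 1) * ladderCoeff b i (j + 1) (k + 1) *
        η (i - (j + 1) + 1) = ∑ j ∈ Finset.range (i + 1),
          (-1) ^ (j + 1) * ladderCoeff b i (j + 1) (k + 1) * η (i - j) := by
      rw [Finset.sum_range_succ, ladderCoeff_of_lt b (Nat.lt_succ_self i), mul_zero, zero_mul,
        add_zero]
      refine Finset.sum_congr rfl fun j hj => ?_
      rw [show i - (j + 1) + 1 = i - j by have := Finset.mem_range.1 hj; omega]
    rw [h, Finset.mul_sum, add_sub_right_comm, ← Finset.sum_sub_distrib]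
    simp only [ladderCoeff_zero, ladderCoeff_succ_succ, Nat.sub_zero, Nat.succ_sub_succ]
    congr 1
    refine Finset.sum_congr rfl fun j _ => ?_
    ring

/-- If all coefficients lie in the subring `O`, then `η` has its first `n` terms in `O`
if and only if the first `n` terms of its ladder do. -/
lemma ladder_mem_iff (O : Subring K) (b : ℕ → ℤ → K) (n : ℕ) (k : ℤ) (η : ℕ → K)
    (h : ∀ i < n, ∀ j ≤ i, ladderCoeff b i j k ∈ O) :
    (∀ i < n, ladder b i k η ∈ O) ↔ ∀ i < n, η i ∈ O := by
  have hsum : ∀ i < n, (∀ j < i, η j ∈ O) → ladder b i k η - η i ∈ O := by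
    intro i hi hη
    rw [ladder_eq_sum, Finset.sum_range_succ', pow_zero, one_mul, ladderCoeff_zero, one_mul,
      Nat.sub_zero, add_sub_cancel_right]
    refine O.sum_mem fun j hj => O.mul_mem (O.mul_mem ?_ (h i hi _ ?_)) (hη _ ?_)
    · exact O.pow_mem (O.neg_mem O.one_mem) _
    all_goals have := Finset.mem_range.1 hj; omega
  constructor
  · intro hl i
    induction i using Nat.strong_induction_on with
    | _ i ih =>
      intro hi
      simpa using O.sub_mem (hl i hi) (hsum i hi fun j hj => ih j hj (hj.trans hi))
  · intro hη i hi
    simpa using O.add_mem (hsum i hi fun j hj => hη j (hj.trans hi)) (hη i hi)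

lemma forall_mem_iff_of_triangular (O : Subring K) (n : ℕ) (P x x' r : ℕ → K)
    (hP : ∀ i < n, P i ≠ 0 ∧ P i ∈ O ∧ (P i)⁻¹ ∈ O)
    (hx : ∀ i < n, x' i = P i * x i + r i)
    (hr : ∀ i < n, (∀ j, i < j → x j ∈ O) → r i ∈ O)
    (h0 : ∀ i, n ≤ i → x i ∈ O) :
    (∀ i < n, x i ∈ O) ↔ ∀ i < n, x' i ∈ O := by
  constructor
  · intro h i hi
    rw [hx i hi]
    refine O.add_mem (O.mul_mem (hP i hi).2.1 (h i hi)) (hr i hi fun j _ => ?_)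
    exact (lt_or_ge j n).elim (h j) (h0 j)
  · intro h
    suffices ∀ m i, n - i ≤ m → x i ∈ O from fun i _ => this _ i le_rfl
    intro m
    induction m with
    | zero => exact fun i hi => h0 i (by omega)
    | succ m ih =>
      intro i hi
      rcases lt_or_ge i n with hin | hin
      · have := hr i hin fun j hj => ih j (by omega)
        have h2 : x i = (P i)⁻¹ * (x' i - r i) := by
          rw [hx i hin, add_sub_cancel_right, inv_mul_cancel_left₀ (hP i hin).1]
        rw [h2]
        exact O.mul_mem (hP i hin).2.2 (O.sub_mem (h i hin) this)
      · exact h0 i hin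

/-- One step of a bidiagonal system, after the unipotent gauge transformations with
superdiagonals `-ε` (source) and `-ε'` (target), preserves the standard lattice. -/
lemma bidiagonal_step_mem_iff (O : Subring K) (n : ℕ) (P g ε ε' v v' : ℕ → K)
    (hv : ∀ i, n ≤ i → v i = 0) (hv' : ∀ i < n, v' i = P i * v i + g i * v (i + 1))
    (hε' : ∀ i, n ≤ i + 1 → ε' i = 0)
    (hP : ∀ i < n, P i ≠ 0 ∧ P i ∈ O ∧ (P i)⁻¹ ∈ O)
    (hεε : ∀ i, ε i * ε (i + 1) = 0)
    (h1 : ∀ i, P i * ε i + g i - ε' i * P (i + 1) ∈ O)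
    (h2 : ∀ i, (P i * ε i + g i - ε' i * P (i + 1)) * ε (i + 1) ∈ O)
    (h3 : ∀ i, ε' i * g (i + 1) ∈ O)
    (h4 : ∀ i, ε' i * g (i + 1) * ε (i + 2) ∈ O) :
    (∀ i < n, v i - ε i * v (i + 1) ∈ O) ↔ ∀ i < n, v' i - ε' i * v' (i + 1) ∈ O := by
  refine forall_mem_iff_of_triangular O n P _ _
    (fun i => (P i * ε i + g i - ε' i * P (i + 1)) * (v (i + 1) - ε (i + 1) * v (i + 2))
      + ((P i * ε i + g i - ε' i * P (i + 1)) * ε (i + 1) - ε' i * g (i + 1))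
        * (v (i + 2) - ε (i + 2) * v (i + 3))
      - ε' i * g (i + 1) * ε (i + 2) * (v (i + 3) - ε (i + 3) * v (i + 4))) hP ?_ ?_ ?_
  · intro i hi
    have hv'' : ε' i * v' (i + 1) = ε' i * (P (i + 1) * v (i + 1) + g (i + 1) * v (i + 2)) := by
      rcases lt_or_ge (i + 1) n with h | h
      · rw [hv' _ h]
      · rw [hε' i h, zero_mul, zero_mul]
    rw [hv'', hv' i hi]
    linear_combination (-(P i * ε i + g i - ε' i * P (i + 1)) * v (i + 3)) * hεε (i + 1) * (-1)
      + ε' i * g (i + 1) * v (i + 4) * hεε (i + 2) * (-1)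
  · intro i _ hx
    exact O.sub_mem (O.add_mem (O.mul_mem (h1 i) (hx _ (by omega)))
      (O.mul_mem (O.sub_mem (h2 i) (h3 i)) (hx _ (by omega)))) (O.mul_mem (h4 i) (hx _ (by omega)))
  · intro i hi
    rw [hv i hi, hv (i + 1) (by omega), mul_zero, sub_zero]
    exact O.zero_mem

end Ladder

section ValueAt

/-- The rational function `f` is holomorphic at `z` with value `c`. -/
def HasValueAt (z : ℂ) (f : RatFunc ℂ) (c : ℂ) : Prop :=
  ∃ p q : ℂ[X], q.eval z ≠ 0 ∧
    f = algebraMap ℂ[X] (RatFunc ℂ) p / algebraMap ℂ[X] (RatFunc ℂ) q ∧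
    c = p.eval z / q.eval z

variable {z : ℂ} {f g : RatFunc ℂ} {c d : ℂ}

lemma ne_zero_of_eval_ne_zero {p : ℂ[X]} (h : p.eval z ≠ 0) : p ≠ 0 := by
  rintro rfl
  simp at h

lemma algebraMap_ratFunc_ne_zero {p : ℂ[X]} (h : p ≠ 0) :
    algebraMap ℂ[X] (RatFunc ℂ) p ≠ 0 :=
  RatFunc.algebraMap_ne_zero h

lemma hasValueAt_algebraMap (z : ℂ) (p : ℂ[X]) :
    HasValueAt z (algebraMap ℂ[X] (RatFunc ℂ) p) (p.eval z) :=
  ⟨p, 1, by simp, by simp, by simp⟩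

lemma HasValueAt.add (hf : HasValueAt z f c) (hg : HasValueAt z g d) :
    HasValueAt z (f + g) (c + d) := by
  obtain ⟨p, q, hq, rfl, rfl⟩ := hf
  obtain ⟨p', q', hq', rfl, rfl⟩ := hg
  refine ⟨p * q' + q * p', q * q', by simp [hq, hq'], ?_, ?_⟩
  · rw [div_add_div _ _ (algebraMap_ratFunc_ne_zero (ne_zero_of_eval_ne_zero hq))
      (algebraMap_ratFunc_ne_zero (ne_zero_of_eval_ne_zero hq'))]
    simp
  · rw [div_add_div _ _ hq hq']
    simp

lemma HasValueAt.mul (hf : HasValueAt z f c) (hg : HasValueAt z g d) :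
    HasValueAt z (f * g) (c * d) := by
  obtain ⟨p, q, hq, rfl, rfl⟩ := hf
  obtain ⟨p', q', hq', rfl, rfl⟩ := hg
  exact ⟨p * p', q * q', by simp [hq, hq'], by simp [div_mul_div_comm],
    by simp [div_mul_div_comm]⟩

lemma HasValueAt.neg (hf : HasValueAt z f c) : HasValueAt z (-f) (-c) := by
  obtain ⟨p, q, hq, rfl, rfl⟩ := hf
  exact ⟨-p, q, hq, by rw [map_neg]; exact (neg_div _ _).symm, by simp [neg_div]⟩

lemma HasValueAt.inv (hf : HasValueAt z f c) (hc : c ≠ 0) : HasValueAt z f⁻¹ c⁻¹ := by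
  obtain ⟨p, q, hq, rfl, rfl⟩ := hf
  exact ⟨q, p, fun h => hc (by simp [h]), by simp, by simp⟩

lemma HasValueAt.div (hf : HasValueAt z f c) (hg : HasValueAt z g d) (hd : d ≠ 0) :
    HasValueAt z (f / g) (c / d) := by
  rw [div_eq_mul_inv, div_eq_mul_inv]
  exact hf.mul (hg.inv hd)

lemma HasValueAt.prod {ι : Type*} {S : Finset ι} {f : ι → RatFunc ℂ} {c : ι → ℂ}
    (h : ∀ i ∈ S, HasValueAt z (f i) (c i)) :
    HasValueAt z (∏ i ∈ S, f i) (∏ i ∈ S, c i) := by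
  induction S using Finset.induction_on with
  | empty => simpa using hasValueAt_algebraMap z 1
  | insert a S ha ih =>
    rw [Finset.prod_insert ha, Finset.prod_insert ha]
    exact (h a (by simp)).mul (ih fun i hi => h i (by simp [hi]))

lemma HasValueAt.num_denom (hf : HasValueAt z f c) :
    f.denom.eval z ≠ 0 ∧ f.eval (RingHom.id ℂ) z = c := by
  obtain ⟨p, q, hq, rfl, rfl⟩ := hf
  have hq0 := ne_zero_of_eval_ne_zero hq
  have hd : (algebraMap ℂ[X] (RatFunc ℂ) p / algebraMap ℂ[X] (RatFunc ℂ) q).denom.eval z ≠ 0 := by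
    obtain ⟨r, hr⟩ := RatFunc.denom_div_dvd p q
    intro h
    apply hq
    rw [hr, Polynomial.eval_mul, h, zero_mul]
  refine ⟨hd, ?_⟩
  have h := congrArg (Polynomial.eval z) (RatFunc.num_mul_eq_mul_denom_iff
    (x := algebraMap ℂ[X] (RatFunc ℂ) p / algebraMap ℂ[X] (RatFunc ℂ) q) hq0 |>.2 rfl)
  rw [RatFunc.eval, Polynomial.eval₂_id, Polynomial.eval₂_id, div_eq_div_iff hd hq]
  simpa using h

lemma HasValueAt.unique (hf : HasValueAt z f c) (hg : HasValueAt z f d) : c = d :=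
  hf.num_denom.2.symm.trans hg.num_denom.2

lemma HasValueAt.div_of_simple_root (hf : HasValueAt z f 0) {p : ℂ[X]} (hp : p.eval z = 0)
    (hp' : p.derivative.eval z ≠ 0) :
    ∃ c, HasValueAt z (f / algebraMap ℂ[X] (RatFunc ℂ) p) c := by
  obtain ⟨a, b, hb, rfl, h⟩ := hf
  have ha : a.eval z = 0 := by
    rcases div_eq_zero_iff.1 h.symm with h | h
    · exact h
    · exact absurd h hb
  obtain ⟨a', rfl⟩ := Polynomial.dvd_iff_isRoot.2 ha
  obtain ⟨p', rfl⟩ := Polynomial.dvd_iff_isRoot.2 hp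
  have hp'' : p'.eval z ≠ 0 := by simpa using hp'
  refine ⟨_, a', b * p', by simp [hb, hp''], ?_, rfl⟩
  have h1 := algebraMap_ratFunc_ne_zero (Polynomial.X_sub_C_ne_zero z)
  have h2 := algebraMap_ratFunc_ne_zero (ne_zero_of_eval_ne_zero hb)
  have h3 := algebraMap_ratFunc_ne_zero (ne_zero_of_eval_ne_zero hp'')
  rw [map_mul, map_mul, map_mul]
  field_simp

/-- The ring of rational functions that are holomorphic at `z`. -/
def holomorphicAt (z : ℂ) : Subring (RatFunc ℂ) where
  carrier := {f | ∃ c, HasValueAt z f c}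
  mul_mem' := fun ⟨_, hf⟩ ⟨_, hg⟩ => ⟨_, hf.mul hg⟩
  one_mem' := ⟨_, by simpa using hasValueAt_algebraMap z 1⟩
  add_mem' := fun ⟨_, hf⟩ ⟨_, hg⟩ => ⟨_, hf.add hg⟩
  zero_mem' := ⟨_, by simpa using hasValueAt_algebraMap z 0⟩
  neg_mem' := fun ⟨_, hf⟩ => ⟨_, hf.neg⟩

lemma HasValueAt.mem (hf : HasValueAt z f c) : f ∈ holomorphicAt z := ⟨c, hf⟩

lemma hasValueAt_eval (hf : f ∈ holomorphicAt z) :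
    HasValueAt z f (f.eval (RingHom.id ℂ) z) := by
  obtain ⟨c, hc⟩ := hf
  rwa [hc.num_denom.2]

lemma HasValueAt.sum {ι : Type*} {S : Finset ι} {f : ι → RatFunc ℂ} {c : ι → ℂ}
    (h : ∀ i ∈ S, HasValueAt z (f i) (c i)) :
    HasValueAt z (∑ i ∈ S, f i) (∑ i ∈ S, c i) := by
  induction S using Finset.induction_on with
  | empty => simpa using hasValueAt_algebraMap z 0
  | insert a S ha ih =>
    rw [Finset.sum_insert ha, Finset.sum_insert ha]
    exact (h a (by simp)).add (ih fun i hi => h i (by simp [hi]))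

/-- A matrix that preserves the lattice of holomorphic vectors, in both directions,
is regular. -/
lemma regularAt_of_mulVec_mem_iff {n : ℕ} {M : Matrix (Fin n) (Fin n) (RatFunc ℂ)}
    (h : ∀ v : Fin n → RatFunc ℂ,
      (∀ i, v i ∈ holomorphicAt z) ↔ ∀ i, (M.mulVec v) i ∈ holomorphicAt z) :
    RegularAt M z := by
  have hM : ∀ i j, M i j ∈ holomorphicAt z := by
    intro i j
    have := (h (Pi.single j 1)).1 (fun i => ?_) i
    · simpa using this
    · rcases eq_or_ne i j with rfl | hij
      · simp
      · simp [hij]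
  refine ⟨fun i j => (hasValueAt_eval (hM i j)).num_denom.1, fun hdet => ?_⟩
  obtain ⟨c, hc, hc0⟩ := Matrix.exists_mulVec_eq_zero_iff.2 hdet
  set π : RatFunc ℂ := algebraMap ℂ[X] (RatFunc ℂ) (X - C z) with hπ
  have hπ0 : π ≠ 0 := algebraMap_ratFunc_ne_zero (Polynomial.X_sub_C_ne_zero z)
  have hconst : ∀ j, HasValueAt z (algebraMap ℂ[X] (RatFunc ℂ) (C (c j))) (c j) := fun j => by
    simpa using hasValueAt_algebraMap z (C (c j))
  have key := (h fun j => algebraMap ℂ[X] (RatFunc ℂ) (C (c j)) / π).2 fun i => by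
    have h1 : HasValueAt z (∑ j, M i j * algebraMap ℂ[X] (RatFunc ℂ) (C (c j)))
        (∑ j, (M i j).eval (RingHom.id ℂ) z * c j) :=
      HasValueAt.sum fun j _ => (hasValueAt_eval (hM i j)).mul (hconst j)
    have h2 : ∑ j, (M i j).eval (RingHom.id ℂ) z * c j = 0 := by
      simpa [Matrix.mulVec, dotProduct] using congrFun hc0 i
    rw [h2] at h1
    have h3 := h1.div_of_simple_root (p := X - C z) (by simp) (by simp)
    rw [Matrix.mulVec, dotProduct]
    simp only [← mul_div_assoc]
    rwa [← Finset.sum_div]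
  apply hc
  funext j
  obtain ⟨a, ha⟩ := key j
  have h1 := ha.mul (hasValueAt_algebraMap z (X - C z))
  rw [div_mul_cancel₀ _ hπ0] at h1
  simpa using (hconst j).unique h1

end ValueAt

section Shift

lemma injective_comp_C_mul_X {c : ℂ} (hc : c ≠ 0) :
    Function.Injective (Polynomial.compRingHom (C c * X : ℂ[X])) := by
  intro p q h
  have := congrArg (fun r : ℂ[X] => r.comp (C c⁻¹ * X)) h
  simpa [Polynomial.comp_assoc, ← mul_assoc, ← C_mul, hc] using this

/-- `qshift c` as a ring homomorphism, for `c ≠ 0`. -/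
def qshiftHom (c : ℂ) (hc : c ≠ 0) : RatFunc ℂ →+* RatFunc ℂ :=
  RatFunc.mapRingHom (Polynomial.compRingHom (C c * X : ℂ[X]))
    (nonZeroDivisors_le_comap_nonZeroDivisors_of_injective _ (injective_comp_C_mul_X hc))

lemma qshiftHom_apply (c : ℂ) (hc : c ≠ 0) (f : RatFunc ℂ) : qshiftHom c hc f = qshift c f := by
  rw [qshiftHom, RatFunc.coe_mapRingHom_eq_coe_map, RatFunc.map_apply]
  rfl

lemma qshift_algebraMap (c : ℂ) (p : ℂ[X]) :
    qshift c (algebraMap ℂ[X] (RatFunc ℂ) p) =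
      algebraMap ℂ[X] (RatFunc ℂ) (p.comp (C c * X)) := by
  simp [qshift]

lemma qshift_pshift (c d : ℂ) (p : ℂ[X]) :
    qshift c (pshift d p) = pshift (d * c) p := by
  rw [pshift, qshift_algebraMap, pshift, Polynomial.comp_assoc]
  simp [C_mul, mul_assoc]

lemma qshift_qshift {c : ℂ} (hc : c ≠ 0) (d : ℂ) (f : RatFunc ℂ) :
    qshift c (qshift d f) = qshift (d * c) f := by
  rw [← qshiftHom_apply c hc, qshift.eq_def d, map_div₀]
  simp only [qshiftHom_apply, ← pshift.eq_def, qshift_pshift]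
  rfl

lemma hasValueAt_pshift (z c : ℂ) (p : ℂ[X]) : HasValueAt z (pshift c p) (p.eval (c * z)) := by
  have h := hasValueAt_algebraMap z (p.comp (C c * X))
  have h1 : eval z (C c * X) = c * z := by simp
  rw [Polynomial.eval_comp, h1] at h
  exact h

lemma pshift_ne_zero {c : ℂ} (hc : c ≠ 0) {p : ℂ[X]} (hp : p ≠ 0) : pshift c p ≠ 0 := by
  refine algebraMap_ratFunc_ne_zero fun h => hp ?_
  exact injective_comp_C_mul_X hc (by simpa using h)

lemma finite_setOf_eval_zpow_mul_eq_zero {q z : ℂ} (hz : z ≠ 0) (hq0 : q ≠ 0)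
    (hq : ∀ m : ℤ, q ^ m = 1 → m = 0) (d : ℂ) (hd : d ≠ 0) {p : ℂ[X]} (hp : p ≠ 0) :
    ∀ᶠ k : ℤ in Filter.cofinite, p.eval (d * q ^ k * z) ≠ 0 := by
  have hinj : Function.Injective fun k : ℤ => d * q ^ k * z := by
    intro a b hab
    have h1 : q ^ a = q ^ b := by
      simpa [hz, hd] using hab
    have := hq (a - b) (by rw [zpow_sub₀ hq0, h1, div_self (zpow_ne_zero _ hq0)])
    omega
  have hfin : {x : ℂ | p.IsRoot x}.Finite := Polynomial.finite_setOfPred_isRoot hp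
  exact (hfin.preimage hinj.injOn).compl_mem_cofinite

lemma eventually_qshift_mem {q z : ℂ} (hz : z ≠ 0) (hq0 : q ≠ 0)
    (hq : ∀ m : ℤ, q ^ m = 1 → m = 0) (f : RatFunc ℂ) :
    ∀ᶠ k : ℤ in Filter.cofinite, qshift (q ^ k) f ∈ holomorphicAt z := by
  filter_upwards [finite_setOf_eval_zpow_mul_eq_zero hz hq0 hq 1 one_ne_zero f.denom_ne_zero]
    with k hk
  rw [one_mul] at hk
  exact ((hasValueAt_pshift z (q ^ k) f.num).div (hasValueAt_pshift z (q ^ k) f.denom) hk).mem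

end Shift

section Local

/-- The data governing the companion system along the orbit `{q ^ k * z}`: functions `W i k`
with at most simple zeros at `z`, nonvanishing functions `P i k`, and the Bethe ansatz equation
at every zero of `W (i + 1) k`, `i + 1 < n`. -/
structure IsBetheSystem (z : ℂ) (n : ℕ) (W P : ℕ → ℤ → RatFunc ℂ) (w p : ℕ → ℤ → ℂ) : Prop where
  W_ne_zero : ∀ i k, W i k ≠ 0
  hasValueAt_W : ∀ i k, HasValueAt z (W i k) (w i k)
  div_mem : ∀ i k, w i k = 0 → ∀ f, HasValueAt z f 0 → f / W i k ∈ holomorphicAt z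
  P_ne_zero : ∀ i k, i < n → P i k ≠ 0
  hasValueAt_P : ∀ i k, i < n → HasValueAt z (P i k) (p i k)
  p_ne_zero : ∀ i k, i < n → p i k ≠ 0
  ne_zero_of_eq_zero : ∀ i k, i + 1 < n → w (i + 1) k = 0 →
    w i k ≠ 0 ∧ w i (k + 1) ≠ 0 ∧ w (i + 1) (k + 1) ≠ 0 ∧ w (i + 1) (k - 1) ≠ 0 ∧
      w (i + 2) (k - 1) ≠ 0 ∧ w (i + 2) k ≠ 0
  bethe : ∀ i k, i + 1 < n → w (i + 1) k = 0 →
    w i k * w (i + 2) (k - 1) * w (i + 1) (k + 1) * p i k =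
      -(p (i + 1) (k - 1) * w i (k + 1) * w (i + 1) (k - 1) * w (i + 2) k)

/-- The superdiagonal of the bidiagonal system. -/
def superdiag (n : ℕ) (W : ℕ → ℤ → RatFunc ℂ) (i : ℕ) (k : ℤ) : RatFunc ℂ :=
  if i + 1 < n then W i (k + 1) * W (i + 2) k / (W (i + 1) k * W (i + 1) (k + 1)) else 0

/-- The superdiagonal of the unipotent gauge transformation removing the poles of the
bidiagonal system. -/
def gaugeEntry (n : ℕ) (W P : ℕ → ℤ → RatFunc ℂ) (w : ℕ → ℤ → ℂ) (i : ℕ) (k : ℤ) : RatFunc ℂ :=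
  if i + 1 < n ∧ w (i + 1) k = 0 then -(superdiag n W i k / P i k) else 0

/-- The diagonal gauge transformation. -/
def diagGauge (W : ℕ → ℤ → RatFunc ℂ) (i : ℕ) (k : ℤ) : RatFunc ℂ :=
  W (i + 1) k / W i k * W 0 (k + i)

namespace IsBetheSystem

variable {z : ℂ} {n : ℕ} {W P : ℕ → ℤ → RatFunc ℂ} {w p : ℕ → ℤ → ℂ}

lemma gauged_superdiag_eq {i : ℕ} {k : ℤ} (h1 : w (i + 1) k ≠ 0) (h2 : w (i + 1) (k + 1) ≠ 0) :
    P i k * gaugeEntry n W P w i k + superdiag n W i k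
      - gaugeEntry n W P w i (k + 1) * P (i + 1) k = superdiag n W i k := by
  rw [gaugeEntry, if_neg (fun h' => h1 h'.2), gaugeEntry, if_neg (fun h' => h2 h'.2)]
  ring

section

variable (h : IsBetheSystem z n W P w p)
include h

lemma W_mem (i : ℕ) (k : ℤ) : W i k ∈ holomorphicAt z := (h.hasValueAt_W i k).mem

lemma W_inv_mem {i : ℕ} {k : ℤ} (hw : w i k ≠ 0) : (W i k)⁻¹ ∈ holomorphicAt z :=
  ((h.hasValueAt_W i k).inv hw).mem

lemma P_mem {i : ℕ} {k : ℤ} (hi : i < n) : P i k ∈ holomorphicAt z := (h.hasValueAt_P i k hi).mem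

lemma P_inv_mem {i : ℕ} {k : ℤ} (hi : i < n) : (P i k)⁻¹ ∈ holomorphicAt z :=
  ((h.hasValueAt_P i k hi).inv (h.p_ne_zero i k hi)).mem

lemma gaugeEntry_mul_gaugeEntry_succ (i : ℕ) (k : ℤ) :
    gaugeEntry n W P w i k * gaugeEntry n W P w (i + 1) k = 0 := by
  by_cases h1 : i + 1 < n ∧ w (i + 1) k = 0
  · have := (h.ne_zero_of_eq_zero i k h1.1 h1.2).2.2.2.2.2
    rw [gaugeEntry.eq_def n W P w (i + 1), if_neg (fun h' => this h'.2), mul_zero]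
  · rw [gaugeEntry, if_neg h1, zero_mul]

lemma superdiag_mem {i : ℕ} {k : ℤ} (h1 : w (i + 1) k ≠ 0) (h2 : w (i + 1) (k + 1) ≠ 0) :
    superdiag n W i k ∈ holomorphicAt z := by
  rw [superdiag]
  split_ifs
  · rw [div_eq_mul_inv, mul_inv]
    exact mul_mem (mul_mem (h.W_mem _ _) (h.W_mem _ _))
      (mul_mem (h.W_inv_mem h1) (h.W_inv_mem h2))
  · exact zero_mem _

lemma gauged_superdiag_of_eq_zero {i : ℕ} {k : ℤ} (hi : i + 1 < n) (h1 : w (i + 1) k = 0) :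
    P i k * gaugeEntry n W P w i k + superdiag n W i k
      - gaugeEntry n W P w i (k + 1) * P (i + 1) k = 0 := by
  have h2 := (h.ne_zero_of_eq_zero i k hi h1).2.2.1
  rw [gaugeEntry, if_pos ⟨hi, h1⟩, gaugeEntry, if_neg (fun h' => h2 h'.2), mul_neg,
    mul_div_cancel₀ _ (h.P_ne_zero i k (by omega))]
  ring

lemma gauged_superdiag_mem (i : ℕ) (k : ℤ) :
    P i k * gaugeEntry n W P w i k + superdiag n W i k
      - gaugeEntry n W P w i (k + 1) * P (i + 1) k ∈ holomorphicAt z := by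
  rcases lt_or_ge (i + 1) n with hi | hi
  swap
  · simp [gaugeEntry, superdiag, hi.not_gt]
  by_cases h1 : w (i + 1) k = 0
  · rw [h.gauged_superdiag_of_eq_zero hi h1]
    exact zero_mem _
  by_cases h2 : w (i + 1) (k + 1) = 0
  swap
  · rw [gauged_superdiag_eq h1 h2]
    exact h.superdiag_mem h1 h2
  obtain ⟨-, -, h3, -, -, -⟩ := h.ne_zero_of_eq_zero i (k + 1) hi h2
  have hb := h.bethe i (k + 1) hi h2
  rw [add_sub_cancel_right] at hb
  have hp := h.p_ne_zero i (k + 1) (by omega)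
  have hval := (((h.hasValueAt_W i (k + 1)).mul (h.hasValueAt_W (i + 2) k)).div
    (h.hasValueAt_W (i + 1) k) h1).add
    ((((h.hasValueAt_W i (k + 1 + 1)).mul (h.hasValueAt_W (i + 2) (k + 1))).mul
      (h.hasValueAt_P (i + 1) k hi)).div ((h.hasValueAt_W (i + 1) (k + 1 + 1)).mul
        (h.hasValueAt_P i (k + 1) (by omega))) (mul_ne_zero h3 hp))
  have h0 : w i (k + 1) * w (i + 2) k / w (i + 1) k
      + w i (k + 1 + 1) * w (i + 2) (k + 1) * p (i + 1) k
        / (w (i + 1) (k + 1 + 1) * p i (k + 1)) = 0 := by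
    rw [div_add_div _ _ h1 (mul_ne_zero h3 hp), div_eq_zero_iff]
    left
    linear_combination hb
  rw [h0] at hval
  have hmem := h.div_mem _ _ h2 _ hval
  convert hmem using 1
  rw [gaugeEntry, if_neg (fun h' => h1 h'.2), gaugeEntry, if_pos ⟨hi, h2⟩, superdiag, if_pos hi,
    superdiag, if_pos hi]
  have e1 := h.W_ne_zero (i + 1) k
  have e2 := h.W_ne_zero (i + 1) (k + 1)
  have e3 := h.W_ne_zero (i + 1) (k + 1 + 1)
  have e4 := h.P_ne_zero i (k + 1) (by omega)
  field_simp
  ring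

lemma superdiag_mul_gaugeEntry_mem {i : ℕ} {k : ℤ} (h0 : w (i + 2) k = 0) :
    superdiag n W i k * gaugeEntry n W P w (i + 1) k ∈ holomorphicAt z := by
  by_cases hi : i + 2 < n
  swap
  · simp [gaugeEntry, hi]
  obtain ⟨h1, h2, h3, -, -, -⟩ := h.ne_zero_of_eq_zero (i + 1) k hi h0
  have e1 := h.W_ne_zero (i + 1) k
  have e2 := h.W_ne_zero (i + 1) (k + 1)
  have e3 := h.W_ne_zero (i + 2) k
  have e4 := h.W_ne_zero (i + 2) (k + 1)
  have e5 := h.P_ne_zero (i + 1) k (by omega)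
  have key : superdiag n W i k * gaugeEntry n W P w (i + 1) k =
      -(W i (k + 1) * W (i + 3) k * ((W (i + 1) k)⁻¹ * (W (i + 2) (k + 1))⁻¹
        * (P (i + 1) k)⁻¹)) := by
    rw [gaugeEntry, if_pos ⟨hi, h0⟩, superdiag, if_pos (by omega), superdiag, if_pos hi]
    field_simp
  rw [key]
  exact neg_mem (mul_mem (mul_mem (h.W_mem _ _) (h.W_mem _ _)) (mul_mem (mul_mem
    (h.W_inv_mem h1) (h.W_inv_mem h3)) (h.P_inv_mem (by omega))))

lemma gauged_superdiag_mul_gaugeEntry_mem (i : ℕ) (k : ℤ) :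
    (P i k * gaugeEntry n W P w i k + superdiag n W i k
      - gaugeEntry n W P w i (k + 1) * P (i + 1) k) * gaugeEntry n W P w (i + 1) k
        ∈ holomorphicAt z := by
  by_cases h0 : i + 2 < n ∧ w (i + 2) k = 0
  · obtain ⟨h1, h2, -, -, -, -⟩ := h.ne_zero_of_eq_zero (i + 1) k h0.1 h0.2
    rw [gauged_superdiag_eq h1 h2]
    exact h.superdiag_mul_gaugeEntry_mem h0.2
  · rw [gaugeEntry.eq_def n W P w (i + 1), if_neg h0, mul_zero]
    exact zero_mem _

lemma gaugeEntry_mul_superdiag_eq {i : ℕ} {k : ℤ} (hi : i + 2 < n) (h0 : w (i + 1) (k + 1) = 0) :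
    gaugeEntry n W P w i (k + 1) * superdiag n W (i + 1) k =
      -(W i (k + 1 + 1) * W (i + 3) k * ((W (i + 1) (k + 1 + 1))⁻¹ * (W (i + 2) k)⁻¹
        * (P i (k + 1))⁻¹)) := by
  have e1 := h.W_ne_zero (i + 1) (k + 1)
  have e2 := h.W_ne_zero (i + 1) (k + 1 + 1)
  have e3 := h.W_ne_zero (i + 2) k
  have e4 := h.W_ne_zero (i + 2) (k + 1)
  have e5 := h.P_ne_zero i (k + 1) (by omega)
  rw [gaugeEntry, if_pos ⟨by omega, h0⟩, superdiag, if_pos (by omega), superdiag, if_pos hi]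
  field_simp

lemma gaugeEntry_mul_superdiag_mem (i : ℕ) (k : ℤ) :
    gaugeEntry n W P w i (k + 1) * superdiag n W (i + 1) k ∈ holomorphicAt z := by
  by_cases hi : i + 2 < n
  swap
  · simp [superdiag, hi]
  by_cases h0 : w (i + 1) (k + 1) = 0
  swap
  · simp [gaugeEntry, h0]
  obtain ⟨-, -, h1, -, h2, -⟩ := h.ne_zero_of_eq_zero i (k + 1) (by omega) h0
  rw [add_sub_cancel_right] at h2
  rw [h.gaugeEntry_mul_superdiag_eq hi h0]
  exact neg_mem (mul_mem (mul_mem (h.W_mem _ _) (h.W_mem _ _)) (mul_mem (mul_mem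
    (h.W_inv_mem h1) (h.W_inv_mem h2)) (h.P_inv_mem (by omega))))

lemma gaugeEntry_mul_superdiag_mul_gaugeEntry_mem (i : ℕ) (k : ℤ) :
    gaugeEntry n W P w i (k + 1) * superdiag n W (i + 1) k * gaugeEntry n W P w (i + 2) k
      ∈ holomorphicAt z := by
  by_cases hi : i + 3 < n
  swap
  · simp [gaugeEntry, hi]
  by_cases h0 : w (i + 1) (k + 1) = 0
  swap
  · simp [gaugeEntry, h0]
  by_cases h3 : w (i + 3) k = 0
  swap
  · simp [gaugeEntry, h3]
  obtain ⟨-, -, h1, -, h2, -⟩ := h.ne_zero_of_eq_zero i (k + 1) (by omega) h0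
  obtain ⟨-, -, h4, -, -, -⟩ := h.ne_zero_of_eq_zero (i + 2) k hi h3
  rw [add_sub_cancel_right] at h2
  have e2 := h.W_ne_zero (i + 1) (k + 1 + 1)
  have e3 := h.W_ne_zero (i + 2) k
  have e5 := h.P_ne_zero i (k + 1) (by omega)
  have e6 := h.W_ne_zero (i + 3) k
  have e7 := h.W_ne_zero (i + 3) (k + 1)
  have e8 := h.P_ne_zero (i + 2) k (by omega)
  have key : gaugeEntry n W P w i (k + 1) * superdiag n W (i + 1) k
      * gaugeEntry n W P w (i + 2) k =
      W i (k + 1 + 1) * W (i + 2) (k + 1) * W (i + 4) k * ((W (i + 1) (k + 1 + 1))⁻¹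
        * (W (i + 2) k)⁻¹ * (P i (k + 1))⁻¹ * (W (i + 3) (k + 1))⁻¹ * (P (i + 2) k)⁻¹) := by
    rw [h.gaugeEntry_mul_superdiag_eq (by omega) h0, gaugeEntry, if_pos ⟨hi, h3⟩, superdiag,
      if_pos hi]
    field_simp
  rw [key]
  exact mul_mem (mul_mem (mul_mem (h.W_mem _ _) (h.W_mem _ _)) (h.W_mem _ _))
    (mul_mem (mul_mem (mul_mem (mul_mem (h.W_inv_mem h1) (h.W_inv_mem h2))
      (h.P_inv_mem (by omega))) (h.W_inv_mem h4)) (h.P_inv_mem (by omega)))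

lemma diagGauge_ne_zero (i : ℕ) (k : ℤ) : diagGauge W i k ≠ 0 :=
  mul_ne_zero (div_ne_zero (h.W_ne_zero _ _) (h.W_ne_zero _ _)) (h.W_ne_zero _ _)

lemma superdiag_eq {i : ℕ} (k : ℤ) (hi : i + 1 < n) :
    superdiag n W i k = diagGauge W (i + 1) k / diagGauge W i (k + 1) := by
  have e1 := h.W_ne_zero (i + 1) k
  have e2 := h.W_ne_zero (i + 1) (k + 1)
  have e3 := h.W_ne_zero i (k + 1)
  have e4 := h.W_ne_zero 0 (k + 1 + i)
  have e5 : k + ((i + 1 : ℕ) : ℤ) = k + 1 + i := by push_cast; ring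
  rw [superdiag, if_pos hi, diagGauge, diagGauge, e5]
  field_simp

end

/-- Coordinates on the solution space after the triangular and the diagonal gauge
transformation. -/
def coord (n : ℕ) (W : ℕ → ℤ → RatFunc ℂ) (b : ℕ → ℤ → RatFunc ℂ) (k : ℤ)
    (η : ℕ → RatFunc ℂ) (i : ℕ) : RatFunc ℂ :=
  if i < n then ladder b i k η / diagGauge W i k else 0

/-- The lattice of initial values at position `k` that is preserved by the system. -/
def InLattice (z : ℂ) (n : ℕ) (W P : ℕ → ℤ → RatFunc ℂ) (w : ℕ → ℤ → ℂ) (b : ℕ → ℤ → RatFunc ℂ)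
    (k : ℤ) (η : ℕ → RatFunc ℂ) : Prop :=
  ∀ i < n, coord n W b k η i - gaugeEntry n W P w i k * coord n W b k η (i + 1) ∈ holomorphicAt z

lemma inLattice_congr {b : ℕ → ℤ → RatFunc ℂ} {k : ℤ} {η η' : ℕ → RatFunc ℂ}
    (hη : ∀ i < n, η i = η' i) : InLattice z n W P w b k η ↔ InLattice z n W P w b k η' := by
  have hc : coord n W b k η = coord n W b k η' := by
    funext i
    rw [coord, coord]
    split_ifs with hi
    · rw [ladder_eq_sum, ladder_eq_sum]
      congr 1
      exact Finset.sum_congr rfl fun j _ => by rw [hη _ (by omega)]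
    · rfl
  rw [InLattice, InLattice, hc]

variable (h : IsBetheSystem z n W P w p) {b : ℕ → ℤ → RatFunc ℂ}
include h

lemma inLattice_succ_iff
    (hb : ∀ i k, i < n → b i k = P i k * (diagGauge W i (k + 1) / diagGauge W i k))
    {k : ℤ} {η : ℕ → RatFunc ℂ} (hη : ladder b n k η = 0) :
    InLattice z n W P w b k η ↔ InLattice z n W P w b (k + 1) fun j => η (j + 1) := by
  refine bidiagonal_step_mem_iff (holomorphicAt z) n (fun i => P i k)
    (fun i => superdiag n W i k) (fun i => gaugeEntry n W P w i k)
    (fun i => gaugeEntry n W P w i (k + 1)) _ _ (fun i hi => if_neg hi.not_gt) ?_ ?_ ?_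
    (fun i => h.gaugeEntry_mul_gaugeEntry_succ i k) (fun i => h.gauged_superdiag_mem i k)
    (fun i => h.gauged_superdiag_mul_gaugeEntry_mem i k)
    (fun i => h.gaugeEntry_mul_superdiag_mem i k)
    (fun i => h.gaugeEntry_mul_superdiag_mul_gaugeEntry_mem i k)
  · intro i hi
    have hl : ladder b i (k + 1) (fun j => η (j + 1)) =
        ladder b (i + 1) k η + b i k * ladder b i k η := by
      rw [ladder]
      ring
    have e1 := h.diagGauge_ne_zero i k
    have e2 := h.diagGauge_ne_zero i (k + 1)
    have e3 := h.diagGauge_ne_zero (i + 1) k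
    rw [coord, if_pos hi, coord, if_pos hi, coord, hl, hb i k hi]
    rcases lt_or_ge (i + 1) n with hi' | hi'
    · rw [if_pos hi', h.superdiag_eq k hi']
      field_simp
      ring
    · rw [if_neg hi'.not_gt, show i + 1 = n by omega, hη]
      field_simp
      ring
  · intro i hi
    exact if_neg fun h' => hi.not_gt h'.1
  · intro i hi
    exact ⟨h.P_ne_zero i k hi, h.P_mem hi, h.P_inv_mem hi⟩

lemma inLattice_iff_of_ne_zero {k : ℤ} (h1 : ∀ i ≤ n, w i k ≠ 0)
    (h2 : ∀ i < n, w 0 (k + i) ≠ 0)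
    (h3 : ∀ i < n, ∀ j ≤ i, ladderCoeff b i j k ∈ holomorphicAt z) (η : ℕ → RatFunc ℂ) :
    InLattice z n W P w b k η ↔ ∀ i < n, η i ∈ holomorphicAt z := by
  rw [← ladder_mem_iff _ b n k η h3]
  refine forall₂_congr fun i hi => ?_
  have hg : gaugeEntry n W P w i k = 0 := if_neg fun h' => h1 (i + 1) h'.1.le h'.2
  rw [hg, zero_mul, sub_zero, coord, if_pos hi]
  have hd := ((h.hasValueAt_W (i + 1) k).div (h.hasValueAt_W i k) (h1 i hi.le)).mul
    (h.hasValueAt_W 0 (k + i))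
  have hd' := hd.inv (mul_ne_zero (div_ne_zero (h1 (i + 1) hi) (h1 i hi.le)) (h2 i hi))
  constructor
  · intro hl
    have := mul_mem hl hd.mem
    rwa [← diagGauge, div_mul_cancel₀ _ (h.diagGauge_ne_zero i k)] at this
  · intro hl
    rw [div_eq_mul_inv]
    exact mul_mem hl hd'.mem

end IsBetheSystem

end Local

section Companion

/-- The entries of a vector in reverse order, extended by a value at `n`. -/
def revSeq {α : Type*} {n : ℕ} (v : Fin n → α) (a : α) (j : ℕ) : α :=
  if hj : j < n then v ⟨n - 1 - j, by omega⟩ else a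

lemma forall_revSeq_iff {α : Type*} {n : ℕ} (Q : α → Prop) (v : Fin n → α) (a : α) :
    (∀ i < n, Q (revSeq v a i)) ↔ ∀ i, Q (v i) := by
  constructor
  · intro h i
    have := h (n - 1 - i) (by omega)
    rw [revSeq, dif_pos (by omega)] at this
    convert this
    omega
  · intro h i hi
    rw [revSeq, dif_pos hi]
    exact h _

variable {K : Type*} [Field K]

/-- The companion matrix of the ladder. -/
def ladderCompanion (b : ℕ → ℤ → K) (n : ℕ) (k : ℤ) : Matrix (Fin n) (Fin n) K :=
  Matrix.of fun i j =>
    if (i : ℕ) = 0 then (-1 : K) ^ (j : ℕ) * ladderCoeff b n ((j : ℕ) + 1) k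
    else if (i : ℕ) = (j : ℕ) + 1 then 1 else 0

lemma ladder_revSeq {n : ℕ} (hn : 0 < n) (b : ℕ → ℤ → K) (k : ℤ) (v : Fin n → K) :
    ladder b n k (revSeq v ((ladderCompanion b n k).mulVec v ⟨0, hn⟩)) = 0 := by
  rw [ladder_eq_sum, Finset.sum_range_succ', ladderCoeff_zero, revSeq, dif_neg (by omega),
    Matrix.mulVec, dotProduct, ← Fin.sum_univ_eq_sum_range (fun j => (-1 : K) ^ (j + 1) *
      ladderCoeff b n (j + 1) k * revSeq v _ (n - (j + 1))), pow_zero, one_mul, one_mul,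
    ← Finset.sum_add_distrib]
  refine Finset.sum_eq_zero fun j _ => ?_
  have hj : (⟨n - 1 - (n - (j + 1)), by omega⟩ : Fin n) = j := Fin.ext (by simp; omega)
  rw [revSeq, dif_pos (by omega), hj, ladderCompanion, Matrix.of_apply, if_pos rfl]
  ring

lemma revSeq_mulVec {n : ℕ} (hn : 0 < n) (b : ℕ → ℤ → K) (k : ℤ) (v : Fin n → K) {j : ℕ}
    (hj : j < n) :
    revSeq v ((ladderCompanion b n k).mulVec v ⟨0, hn⟩) (j + 1) =
      revSeq ((ladderCompanion b n k).mulVec v) 0 j := by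
  rw [revSeq.eq_def _ 0, dif_pos hj, revSeq]
  split_ifs with h
  · rw [Matrix.mulVec, dotProduct, Finset.sum_eq_single (⟨n - 1 - (j + 1), by omega⟩ : Fin n)]
    · rw [ladderCompanion, Matrix.of_apply, if_neg (by simp; omega), if_pos (by simp; omega),
        one_mul]
    · intro c _ hc
      rw [ladderCompanion, Matrix.of_apply, if_neg (by simp; omega), if_neg, zero_mul]
      intro h'
      refine hc (Fin.ext ?_)
      simp at h' ⊢
      omega
    · simp
  · congr 1
    exact Fin.ext (by simp; omega)

/-- If each matrix `A k` maps the set `L k` exactly to `L (k + 1)`, then so do their products. -/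
lemma mulVec_prod_iff {n : ℕ} (A : ℤ → Matrix (Fin n) (Fin n) K) (L : ℤ → (Fin n → K) → Prop)
    (h : ∀ k v, L k v ↔ L (k + 1) ((A k).mulVec v)) (N : ℤ) (m : ℕ) (v : Fin n → K) :
    L (N + 1 - m) v ↔
      L (N + 1) ((((List.range m).map fun k : ℕ => A (N - k)).prod).mulVec v) := by
  induction m generalizing v with
  | zero => simp
  | succ m ih =>
    rw [List.range_succ, List.map_append, List.prod_append, List.map_singleton,
      List.prod_singleton, ← Matrix.mulVec_mulVec, ← ih, h]
    have e1 : N + 1 - ((m + 1 : ℕ) : ℤ) = N - m := by push_cast; ring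
    have e2 : N - (m : ℤ) + 1 = N + 1 - m := by ring
    rw [e1, e2]

end Companion

lemma IsBetheSystem.exists_regularAt_prod {z : ℂ} {n : ℕ} {W P : ℕ → ℤ → RatFunc ℂ}
    {w p : ℕ → ℤ → ℂ} (h : IsBetheSystem z n W P w p) (hn : 0 < n) {b : ℕ → ℤ → RatFunc ℂ}
    (hb : ∀ i k, i < n → b i k = P i k * (diagGauge W i (k + 1) / diagGauge W i k))
    (hw : ∀ i, ∀ᶠ k in Filter.cofinite, w i k ≠ 0)
    (hc : ∀ i j, ∀ᶠ k in Filter.cofinite, ladderCoeff b i j k ∈ holomorphicAt z) :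
    ∃ N0 : ℕ, ∀ N N' : ℕ, N0 ≤ N → N0 ≤ N' →
      RegularAt (((List.range (N + N' + 1)).map fun k : ℕ =>
        ladderCompanion b n ((N : ℤ) - (k : ℤ))).prod) z := by
  have hstep : ∀ k v, InLattice z n W P w b k (revSeq v 0) ↔
      InLattice z n W P w b (k + 1) (revSeq ((ladderCompanion b n k).mulVec v) 0) := by
    intro k v
    rw [inLattice_congr (η' := revSeq v ((ladderCompanion b n k).mulVec v ⟨0, hn⟩)),
      h.inLattice_succ_iff hb (ladder_revSeq hn b k v),
      inLattice_congr fun i hi => revSeq_mulVec hn b k v hi]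
    intro i hi
    rw [revSeq, dif_pos hi, revSeq, dif_pos hi]
  have hfar : ∀ᶠ k in Filter.cofinite, ∀ v : Fin n → RatFunc ℂ,
      InLattice z n W P w b k (revSeq v 0) ↔ ∀ i, v i ∈ holomorphicAt z := by
    have h1 : ∀ᶠ k in Filter.cofinite, ∀ i ∈ Set.Iic n, w i k ≠ 0 :=
      (Filter.eventually_all_finite (Set.finite_Iic n)).2 fun i _ => hw i
    have h2 : ∀ᶠ k : ℤ in Filter.cofinite, ∀ i ∈ Set.Iio n, w 0 (k + i) ≠ 0 :=
      (Filter.eventually_all_finite (Set.finite_Iio n)).2 fun i _ =>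
        (add_left_injective (i : ℤ)).tendsto_cofinite.eventually (hw 0)
    have h3 : ∀ᶠ k in Filter.cofinite, ∀ i ∈ Set.Iio n, ∀ j ∈ Set.Iic i,
        ladderCoeff b i j k ∈ holomorphicAt z :=
      (Filter.eventually_all_finite (Set.finite_Iio n)).2 fun i _ =>
        (Filter.eventually_all_finite (Set.finite_Iic i)).2 fun j _ => hc i j
    filter_upwards [h1, h2, h3] with k h1 h2 h3 v
    rw [h.inLattice_iff_of_ne_zero h1 h2 h3, forall_revSeq_iff (· ∈ holomorphicAt z)]
  rw [Int.cofinite_eq, Filter.eventually_sup, Filter.eventually_atBot,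
    Filter.eventually_atTop] at hfar
  obtain ⟨⟨m, hm⟩, ⟨M, hM⟩⟩ := hfar
  refine ⟨m.natAbs + M.natAbs, fun N N' hN hN' => regularAt_of_mulVec_mem_iff fun v => ?_⟩
  have := mulVec_prod_iff _ _ hstep N (N + N' + 1) v
  rwa [hm _ (by push_cast; omega), hM _ (by omega)] at this

section BetheData

/-- The polynomial `y_i` at `q_3 ^ (1 - i) q_2 ^ k x`. -/
def yShift (n : ℕ) (q2 q3 : ℂ) (l : ZMod n → ℕ) (s : (ν : ZMod n) → Fin (l ν) → ℂ)
    (i : ℕ) (k : ℤ) : RatFunc ℂ :=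
  pshift (q3 ^ ((1 : ℤ) - i) * q2 ^ k) (yP n l s (i : ZMod n))

/-- The value of `yShift` at `z`. -/
def yShiftVal (n : ℕ) (q2 q3 : ℂ) (l : ZMod n → ℕ) (s : (ν : ZMod n) → Fin (l ν) → ℂ) (z : ℂ)
    (i : ℕ) (k : ℤ) : ℂ :=
  (yP n l s (i : ZMod n)).eval (q3 ^ ((1 : ℤ) - i) * q2 ^ k * z)

/-- The product of the functions `Ψ̃_ν` in `b_{i+1}`, at `q_2 ^ k x`. -/
def psiProd (n : ℕ) (q1 q2 : ℂ) (F G : ZMod n → ℂ[X]) (i : ℕ) (k : ℤ) : RatFunc ℂ :=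
  ∏ ν ∈ Finset.Icc 1 i, psiR n F G (ν : ZMod n) (q1 ^ (ν - 1) * q2 ^ i * q2 ^ k)

/-- The value of `psiProd` at `z`. -/
def psiProdVal (n : ℕ) (q1 q2 : ℂ) (F G : ZMod n → ℂ[X]) (z : ℂ) (i : ℕ) (k : ℤ) : ℂ :=
  ∏ ν ∈ Finset.Icc 1 i, (G (ν : ZMod n)).eval (q1 ^ (ν - 1) * q2 ^ i * q2 ^ k * z) /
    (F (ν : ZMod n)).eval (q1 ^ (ν - 1) * q2 ^ i * q2 ^ k * z)

/-- `b_{i+1}(q_2 ^ k x)`. -/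
def bSeq (n : ℕ) (q1 q2 q3 : ℂ) (l : ZMod n → ℕ) (s : (ν : ZMod n) → Fin (l ν) → ℂ)
    (F G : ZMod n → ℂ[X]) (i : ℕ) (k : ℤ) : RatFunc ℂ :=
  qshift (q2 ^ k) (bf n q1 q2 q3 l s F G (i + 1))

variable {n : ℕ} {q1 q2 q3 : ℂ} {l : ZMod n → ℕ} {s : (ν : ZMod n) → Fin (l ν) → ℂ}
  {F G : ZMod n → ℂ[X]}

lemma yP_monic (ν : ZMod n) : (yP n l s ν).Monic :=
  Polynomial.monic_prod_of_monic _ _ fun _ _ => Polynomial.monic_X_sub_C _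

lemma eval_yP_eq_zero_iff (ν : ZMod n) (x : ℂ) : (yP n l s ν).eval x = 0 ↔ ∃ a, x = s ν a := by
  simp [yP, Polynomial.eval_prod, Finset.prod_eq_zero_iff, sub_eq_zero]

lemma ladderCoeff_bSeq (hq2 : q2 ≠ 0) (N j : ℕ) (k m : ℤ) :
    qshift (q2 ^ k) (ladderCoeff (bSeq n q1 q2 q3 l s F G) N j m) =
      ladderCoeff (bSeq n q1 q2 q3 l s F G) N j (m + k) := by
  rw [← qshiftHom_apply _ (zpow_ne_zero k hq2), ladderCoeff, ladderCoeff, map_sum]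
  refine Finset.sum_congr rfl fun v _ => ?_
  rw [map_prod]
  refine Finset.prod_congr rfl fun i _ => ?_
  rw [qshiftHom_apply, bSeq, bSeq, qshift_qshift (zpow_ne_zero k hq2), ← zpow_add₀ hq2]
  congr 2
  ring

lemma tf_eq_ladderCoeff (j : ℕ) :
    tf n q1 q2 q3 l s F G j = ladderCoeff (bSeq n q1 q2 q3 l s F G) n j 0 := by
  rw [tf, ladderCoeff]
  refine Finset.sum_congr rfl fun v _ => Finset.prod_congr rfl fun i _ => ?_
  rw [bSeq]
  congr 2
  ring

lemma compA_map_qshift (hq2 : q2 ≠ 0) (k : ℤ) :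
    (compA n q1 q2 q3 l s F G).map (qshift (q2 ^ k)) =
      ladderCompanion (bSeq n q1 q2 q3 l s F G) n k := by
  ext i j
  rw [Matrix.map_apply, compA, ladderCompanion, Matrix.of_apply, Matrix.of_apply,
    ← qshiftHom_apply _ (zpow_ne_zero k hq2)]
  split_ifs
  · rw [map_mul, map_pow, map_neg, map_one, tf_eq_ladderCoeff, qshiftHom_apply,
      ladderCoeff_bSeq hq2, zero_add]
  · exact map_one _
  · exact map_zero _

lemma yShift_ne_zero (hq2 : q2 ≠ 0) (hq3 : q3 ≠ 0) (i : ℕ) (k : ℤ) :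
    yShift n q2 q3 l s i k ≠ 0 :=
  pshift_ne_zero (mul_ne_zero (zpow_ne_zero _ hq3) (zpow_ne_zero _ hq2)) (yP_monic _).ne_zero

lemma bSeq_eq (hq2 : q2 ≠ 0) (hq3 : q3 ≠ 0) (i : ℕ) (k : ℤ) :
    bSeq n q1 q2 q3 l s F G i k = psiProd n q1 q2 F G i k *
      (diagGauge (yShift n q2 q3 l s) i (k + 1) / diagGauge (yShift n q2 q3 l s) i k) := by
  have hk := zpow_ne_zero k hq2
  have hy := fun i k => yShift_ne_zero (n := n) (l := l) (s := s) hq2 hq3 i k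
  have hyk : ∀ (i : ℕ) (k : ℤ) (c : ℂ) (ν : ZMod n), c = q3 ^ ((1 : ℤ) - i) * q2 ^ k →
      ν = (i : ZMod n) → pshift c (yP n l s ν) = yShift n q2 q3 l s i k := by
    rintro i k c ν rfl rfl
    rfl
  rw [bSeq, ← qshiftHom_apply _ hk, bf, diagGauge, diagGauge]
  have e0 := hy i k
  have e1 := hy i (k + 1)
  have e2 := hy (i + 1) k
  have e3 := hy (i + 1) (k + 1)
  have e4 := hy 0 (k + i)
  have e5 := hy 0 (k + 1 + i)
  split_ifs with hi
  · obtain rfl : i = 0 := by omega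
    rw [map_div₀, qshiftHom_apply, qshiftHom_apply, qshift_algebraMap, qshift_pshift, ← pshift,
      hyk 1 (k + 1) _ _ (by simp [zpow_add₀ hq2, mul_comm]) (by simp),
      hyk 1 k _ _ (by simp) (by simp), psiProd]
    simp only [Nat.cast_zero, add_zero, zero_add] at *
    field_simp
    simp
  · simp only [map_mul, map_div₀, map_prod, qshiftHom_apply, psiR, qshift_pshift]
    rw [hyk i k _ _ (by push_cast; ring_nf) (by push_cast; ring),
      hyk i (k + 1) _ _ (by rw [zpow_add₀ hq2, zpow_one]; push_cast; ring_nf)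
        (by push_cast; ring),
      hyk (i + 1) (k + 1) _ _ (by rw [zpow_add₀ hq2, zpow_one]; ring) rfl,
      hyk (i + 1) k _ _ rfl rfl,
      hyk 0 (k + 1 + i) _ _ (by
        rw [zpow_add₀ hq2, zpow_add₀ hq2, zpow_one, zpow_natCast]; simp; ring) (by simp),
      hyk 0 (k + i) _ _ (by rw [zpow_add₀ hq2, zpow_natCast]; simp; ring) (by simp), psiProd]
    simp only [Nat.add_sub_cancel, psiR]
    field_simp
    refine Finset.prod_congr rfl fun ν _ => ?_
    rw [show q2 ^ i * q2 ^ k * q1 ^ (ν - 1) = q1 ^ (ν - 1) * q2 ^ i * q2 ^ k by ring]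

end BetheData

lemma isBetheSystem_yShift {n : ℕ} {q1 q2 q3 : ℂ} (hq : q1 * q2 * q3 = 1)
    {l : ZMod n → ℕ} {s : (ν : ZMod n) → Fin (l ν) → ℂ} (hs0 : ∀ ν i, s ν i ≠ 0)
    {F G : ZMod n → ℂ[X]}
    (hsep : ∀ (μ ν : ZMod n) (i : Fin (l μ)) (j : Fin (l ν)) (m : ℤ),
      s μ i = q2 ^ m * s ν j → μ = ν ∧ (i : ℕ) = (j : ℕ))
    (hreg : ∀ (μ ν : ZMod n) (a : Fin (l ν)) (i j : ℤ),
      (F μ).eval (q1 ^ i * q2 ^ j * s ν a) ≠ 0 ∧ (G μ).eval (q1 ^ i * q2 ^ j * s ν a) ≠ 0)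
    (hBAE : ∀ ν : ZMod n, ν ≠ 0 → ∀ i : Fin (l ν), BAE n q1 q2 q3 l s F G ν (s ν i))
    (e f : ℤ) (μ : ZMod n) (a : Fin (l μ)) :
    IsBetheSystem (q1 ^ e * q2 ^ f * s μ a) n (yShift n q2 q3 l s) (psiProd n q1 q2 F G)
      (yShiftVal n q2 q3 l s (q1 ^ e * q2 ^ f * s μ a))
      (psiProdVal n q1 q2 F G (q1 ^ e * q2 ^ f * s μ a)) := by
  have hq1 : q1 ≠ 0 := by rintro rfl; simp at hq
  have hq2 : q2 ≠ 0 := by rintro rfl; simp at hq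
  have hq3 : q3 ≠ 0 := by rintro rfl; simp at hq
  set z := q1 ^ e * q2 ^ f * s μ a with hz
  have hz0 : z ≠ 0 := mul_ne_zero (mul_ne_zero (zpow_ne_zero _ hq1) (zpow_ne_zero _ hq2)) (hs0 _ _)
  have hinj : ∀ ν, Function.Injective (s ν) := fun ν i j hij =>
    Fin.ext (hsep ν ν i j 0 (by simpa using hij)).2
  have hFG : ∀ (ν : ZMod n) (c d : ℕ) (k : ℤ), (F ν).eval (q1 ^ c * q2 ^ d * q2 ^ k * z) ≠ 0 ∧
      (G ν).eval (q1 ^ c * q2 ^ d * q2 ^ k * z) ≠ 0 := by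
    intro ν c d k
    have h := hreg ν μ a (c + e) (d + k + f)
    rw [zpow_add₀ hq1, zpow_add₀ hq2, zpow_add₀ hq2, zpow_natCast, zpow_natCast] at h
    have e1 : q1 ^ c * q2 ^ d * q2 ^ k * z =
        q1 ^ c * q1 ^ e * (q2 ^ d * q2 ^ k * q2 ^ f) * s μ a := by rw [hz]; ring
    rwa [e1]
  have hBAE' : ∀ (i : ℕ) (k : ℤ), i + 1 < n → yShiftVal n q2 q3 l s z (i + 1) k = 0 →
      ∃ r : ℂ, r ≠ 0 ∧ psiProdVal n q1 q2 F G z (i + 1) (k - 1) = psiProdVal n q1 q2 F G z i k * r ∧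
        yShiftVal n q2 q3 l s z (i + 1) (k + 1) / yShiftVal n q2 q3 l s z (i + 1) (k - 1) *
        (yShiftVal n q2 q3 l s z i k / yShiftVal n q2 q3 l s z i (k + 1)) *
        (yShiftVal n q2 q3 l s z (i + 2) (k - 1) / yShiftVal n q2 q3 l s z (i + 2) k) = -r := by
    intro i k hi hw
    obtain ⟨t, ht⟩ := (eval_yP_eq_zero_iff _ _).1 hw
    have hν : ((i + 1 : ℕ) : ZMod n) ≠ 0 := by
      rw [Ne, ZMod.natCast_eq_zero_iff]
      exact fun hd => absurd (Nat.le_of_dvd (by omega) hd) (by omega)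
    have hB := hBAE _ hν t
    have hr := hreg ((i + 1 : ℕ) : ZMod n) _ t 0 0
    simp only [zpow_zero, one_mul] at hr
    refine ⟨_, div_ne_zero hr.2 hr.1, ?_, ?_⟩
    · rw [psiProdVal, psiProdVal, Finset.prod_Icc_succ_top (by omega)]
      have e1 : q1 ^ (i + 1 - 1) * q2 ^ (i + 1) * q2 ^ (k - 1) * z = s _ t := by
        rw [← ht, Nat.add_sub_cancel, zpow_sub₀ hq2, zpow_one]
        have : q3 ^ ((1 : ℤ) - ((i + 1 : ℕ) : ℤ)) = q1 ^ i * q2 ^ i := by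
          rw [show (1 : ℤ) - ((i + 1 : ℕ) : ℤ) = -(i : ℤ) by push_cast; ring, zpow_neg,
            zpow_natCast, inv_eq_iff_eq_inv, ← mul_pow, ← inv_pow]
          congr 1
          exact eq_inv_of_mul_eq_one_right hq
        rw [this, pow_succ]
        field_simp
      rw [e1]
      congr 1
      refine Finset.prod_congr rfl fun ν _ => ?_
      have e2 : q1 ^ (ν - 1) * q2 ^ (i + 1) * q2 ^ (k - 1) * z =
          q1 ^ (ν - 1) * q2 ^ i * q2 ^ k * z := by
        rw [zpow_sub₀ hq2, zpow_one, pow_succ]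
        field_simp
      rw [e2]
    · rw [← hB]
      have hsplit : q3 ^ ((1 : ℤ) - i) = q3 * q3 ^ ((1 : ℤ) - ((i + 1 : ℕ) : ℤ)) := by
        rw [← zpow_one_add₀ hq3]
        congr 1
        push_cast
        ring
      have hsplit' : q3 ^ ((1 : ℤ) - ((i + 2 : ℕ) : ℤ)) =
          q3⁻¹ * q3 ^ ((1 : ℤ) - ((i + 1 : ℕ) : ℤ)) := by
        rw [← zpow_neg_one, ← zpow_add₀ hq3]
        congr 1
        push_cast
        ring
      have hq1' : q1⁻¹ = q2 * q3 := by
        rw [eq_comm]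
        exact eq_inv_of_mul_eq_one_right (by rw [← hq]; ring)
      have hq1'' : q1 = q3⁻¹ * q2⁻¹ := by
        rw [← mul_inv, eq_comm, inv_eq_iff_eq_inv, hq1', mul_comm]
      have hm : ((i + 1 : ℕ) : ZMod n) - 1 = (i : ZMod n) := by push_cast; ring
      have hp : ((i + 1 : ℕ) : ZMod n) + 1 = ((i + 2 : ℕ) : ZMod n) := by push_cast; ring
      simp only [yShiftVal]
      rw [hm, hp, hsplit, hsplit', hq1', ← ht, zpow_add₀ hq2, zpow_sub₀ hq2, zpow_one]
      have a1 : ∀ x, q3 ^ ((1 : ℤ) - ((i + 1 : ℕ) : ℤ)) * (q2 ^ k * q2) * x =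
        q2 * (q3 ^ ((1 : ℤ) - ((i + 1 : ℕ) : ℤ)) * q2 ^ k * x) := fun x => by ring
      have a2 : ∀ x, q3 ^ ((1 : ℤ) - ((i + 1 : ℕ) : ℤ)) * (q2 ^ k / q2) * x =
        q2⁻¹ * (q3 ^ ((1 : ℤ) - ((i + 1 : ℕ) : ℤ)) * q2 ^ k * x) := fun x => by ring
      have a3 : ∀ x, q3⁻¹ * q3 ^ ((1 : ℤ) - ((i + 1 : ℕ) : ℤ)) * (q2 ^ k / q2) * x =
        q1 * (q3 ^ ((1 : ℤ) - ((i + 1 : ℕ) : ℤ)) * q2 ^ k * x) := fun x => by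
          rw [hq1'']; ring
      have a4 : ∀ x, q3 * q3 ^ ((1 : ℤ) - ((i + 1 : ℕ) : ℤ)) * (q2 ^ k * q2) * x =
        q2 * q3 * (q3 ^ ((1 : ℤ) - ((i + 1 : ℕ) : ℤ)) * q2 ^ k * x) := fun x => by ring
      simp only [a1, a2, a3, a4]
      simp only [mul_assoc]
  have hne : ∀ (i : ℕ) (k : ℤ), i + 1 < n → yShiftVal n q2 q3 l s z (i + 1) k = 0 →
      yShiftVal n q2 q3 l s z i k ≠ 0 ∧ yShiftVal n q2 q3 l s z i (k + 1) ≠ 0 ∧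
      yShiftVal n q2 q3 l s z (i + 1) (k + 1) ≠ 0 ∧ yShiftVal n q2 q3 l s z (i + 1) (k - 1) ≠ 0 ∧
      yShiftVal n q2 q3 l s z (i + 2) (k - 1) ≠ 0 ∧ yShiftVal n q2 q3 l s z (i + 2) k ≠ 0 := by
    intro i k hi hw
    obtain ⟨r, hr, -, h⟩ := hBAE' i k hi hw
    have h0 := neg_ne_zero.2 hr
    rw [← h] at h0
    simp only [ne_eq, mul_eq_zero, div_eq_zero_iff, not_or] at h0
    tauto
  refine ⟨yShift_ne_zero hq2 hq3, fun i k => hasValueAt_pshift _ _ _, ?_, ?_, ?_, ?_, hne, ?_⟩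
  · intro i k hw g hg
    refine hg.div_of_simple_root (by simpa [yShiftVal] using hw) ?_
    have hsq : (yP n l s (i : ZMod n)).Separable :=
      Polynomial.separable_prod_X_sub_C_iff.2 (hinj _)
    have := hsq.eval₂_derivative_ne_zero (RingHom.id ℂ) (x := q3 ^ ((1 : ℤ) - i) * q2 ^ k * z)
      (by rw [Polynomial.eval₂_id]; exact hw)
    rw [Polynomial.eval₂_id] at this
    have hc := mul_ne_zero (zpow_ne_zero ((1 : ℤ) - i) hq3) (zpow_ne_zero k hq2)
    rw [Polynomial.derivative_comp, Polynomial.eval_mul, Polynomial.eval_comp]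
    refine mul_ne_zero (by simpa using hc) ?_
    simpa using this
  · intro i k _
    refine Finset.prod_ne_zero_iff.2 fun ν _ => ?_
    have hc : q1 ^ (ν - 1) * q2 ^ i * q2 ^ k ≠ 0 :=
      mul_ne_zero (mul_ne_zero (pow_ne_zero _ hq1) (pow_ne_zero _ hq2)) (zpow_ne_zero _ hq2)
    have h := hFG (ν : ZMod n) 0 0 0
    exact div_ne_zero (pshift_ne_zero hc (ne_zero_of_eval_ne_zero h.2))
      (pshift_ne_zero hc (ne_zero_of_eval_ne_zero h.1))
  · intro i k _
    exact HasValueAt.prod fun ν _ => (hasValueAt_pshift z _ _).div (hasValueAt_pshift z _ _)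
      (hFG _ _ _ _).1
  · intro i k _
    exact Finset.prod_ne_zero_iff.2 fun ν _ => div_ne_zero (hFG _ _ _ _).2 (hFG _ _ _ _).1
  · intro i k hi hw
    obtain ⟨r, hr, hpr, h⟩ := hBAE' i k hi hw
    obtain ⟨h1, h2, h3, h4, h5, h6⟩ := hne i k hi hw
    rw [hpr]
    have h' : r = -(yShiftVal n q2 q3 l s z (i + 1) (k + 1) /
        yShiftVal n q2 q3 l s z (i + 1) (k - 1) *
        (yShiftVal n q2 q3 l s z i k / yShiftVal n q2 q3 l s z i (k + 1)) *
        (yShiftVal n q2 q3 l s z (i + 2) (k - 1) / yShiftVal n q2 q3 l s z (i + 2) k)) := by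
      rw [h, neg_neg]
    rw [h']
    field_simp

lemma isApparent_compA {n : ℕ} (hn : 2 ≤ n) {q1 q2 q3 : ℂ} (hq : q1 * q2 * q3 = 1)
    (hgen : ∀ a b : ℤ, q1 ^ a * q2 ^ b = 1 → a = 0 ∧ b = 0)
    {l : ZMod n → ℕ} {s : (ν : ZMod n) → Fin (l ν) → ℂ} (hs0 : ∀ ν i, s ν i ≠ 0)
    {F G : ZMod n → ℂ[X]}
    (hsep : ∀ (μ ν : ZMod n) (i : Fin (l μ)) (j : Fin (l ν)) (m : ℤ),
      s μ i = q2 ^ m * s ν j → μ = ν ∧ (i : ℕ) = (j : ℕ))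
    (hreg : ∀ (μ ν : ZMod n) (a : Fin (l ν)) (i j : ℤ),
      (F μ).eval (q1 ^ i * q2 ^ j * s ν a) ≠ 0 ∧ (G μ).eval (q1 ^ i * q2 ^ j * s ν a) ≠ 0)
    (hBAE : ∀ ν : ZMod n, ν ≠ 0 → ∀ i : Fin (l ν), BAE n q1 q2 q3 l s F G ν (s ν i))
    (e f : ℤ) (μ : ZMod n) (a : Fin (l μ)) :
    IsApparent q2 (compA n q1 q2 q3 l s F G) (q1 ^ e * q2 ^ f * s μ a) := by
  have hq1 : q1 ≠ 0 := by rintro rfl; simp at hq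
  have hq2 : q2 ≠ 0 := by rintro rfl; simp at hq
  have hq3 : q3 ≠ 0 := by rintro rfl; simp at hq
  have hz0 : q1 ^ e * q2 ^ f * s μ a ≠ 0 :=
    mul_ne_zero (mul_ne_zero (zpow_ne_zero _ hq1) (zpow_ne_zero _ hq2)) (hs0 _ _)
  have hq2' : ∀ m : ℤ, q2 ^ m = 1 → m = 0 := fun m hm => (hgen 0 m (by simpa using hm)).2
  have h := isBetheSystem_yShift hq hs0 hsep hreg hBAE e f μ a
  obtain ⟨N0, hN0⟩ := h.exists_regularAt_prod (by omega)
    (fun i k _ => bSeq_eq (F := F) (G := G) (q1 := q1) hq2 hq3 i k)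
    (fun i => finite_setOf_eval_zpow_mul_eq_zero hz0 hq2 hq2' _ (zpow_ne_zero _ hq3)
      (yP_monic _).ne_zero)
    (fun i j => by
      filter_upwards [eventually_qshift_mem hz0 hq2 hq2'
        (ladderCoeff (bSeq n q1 q2 q3 l s F G) i j 0)] with k hk
      rwa [ladderCoeff_bSeq hq2, zero_add] at hk)
  refine ⟨N0, fun N N' hN hN' => ?_⟩
  simp only [compA_map_qshift hq2]
  simp only [List.bind_eq_flatMap, List.pure_def, ← List.map_eq_flatMap, List.map_map]
  exact hN0 N N' hN hN'

/-- Proposition 5.2: under the Bethe ansatz equations (BAE)_ν,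
`1 ≤ ν ≤ n−1`, the points `q_3^{-1} q_2^{-j} s^{(0)}_a` (`1 ≤ j ≤ n`) and
`q_3^{n-1} q_2^{-j} s^{(0)}_a` (`j = 0, 1`) are apparent singularities of the
companion system `Y(q_2 x) = A(x) Y(x)`. -/
theorem bethe_apparent_singularities
    (n : ℕ) (hn : 2 ≤ n) (q1 q2 q3 : ℂ) (hq : q1 * q2 * q3 = 1)
    (hgen : ∀ a b : ℤ, q1 ^ a * q2 ^ b = 1 → a = 0 ∧ b = 0)
    (l : ZMod n → ℕ) (s : (ν : ZMod n) → Fin (l ν) → ℂ)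
    (hs0 : ∀ ν i, s ν i ≠ 0)
    (F G : ZMod n → Polynomial ℂ)
    (hcop : ∀ ν, IsCoprime (F ν) (G ν)) (hmon : ∀ ν, (F ν).Monic)
    (hsep : ∀ (μ ν : ZMod n) (i : Fin (l μ)) (j : Fin (l ν)) (m : ℤ),
      s μ i = q2 ^ m * s ν j → μ = ν ∧ (i : ℕ) = (j : ℕ))
    (hreg : ∀ (μ ν : ZMod n) (a : Fin (l ν)) (i j : ℤ),
      (F μ).eval (q1 ^ i * q2 ^ j * s ν a) ≠ 0 ∧ (G μ).eval (q1 ^ i * q2 ^ j * s ν a) ≠ 0)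
    (hBAE : ∀ ν : ZMod n, ν ≠ 0 → ∀ i : Fin (l ν), BAE n q1 q2 q3 l s F G ν (s ν i))
 :
    ∀ a : Fin (l 0),
      (∀ j : ℕ, 1 ≤ j → j ≤ n →
          IsApparent q2 (compA n q1 q2 q3 l s F G)
            (q3⁻¹ * q2 ^ (-(j : ℤ)) * s 0 a)) ∧
        IsApparent q2 (compA n q1 q2 q3 l s F G) (q3 ^ (n - 1) * s 0 a) ∧
        IsApparent q2 (compA n q1 q2 q3 l s F G) (q3 ^ (n - 1) * q2⁻¹ * s 0 a) := by
  have hq1 : q1 ≠ 0 := by rintro rfl; simp at hq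
  have hq2 : q2 ≠ 0 := by rintro rfl; simp at hq
  have hq3 : q3⁻¹ = q1 * q2 := (eq_inv_of_mul_eq_one_left hq).symm
  have hq3' : q3 ^ (n - 1) = q1 ^ (-((n - 1 : ℕ) : ℤ)) * q2 ^ (-((n - 1 : ℕ) : ℤ)) := by
    rw [← mul_zpow, ← hq3, zpow_neg, zpow_natCast, inv_pow, inv_inv]
  have key := isApparent_compA hn hq hgen hs0 hsep hreg hBAE
  refine fun a => ⟨fun j _ _ => ?_, ?_, ?_⟩
  · convert key 1 (1 - j) 0 a using 1
    rw [hq3, zpow_sub₀ hq2, zpow_neg, zpow_one, zpow_one]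
    ring
  · rw [hq3']
    exact key _ _ 0 a
  · convert key (-((n - 1 : ℕ) : ℤ)) (-((n - 1 : ℕ) : ℤ) - 1) 0 a using 1
    rw [hq3', zpow_sub₀ hq2, zpow_one]
    ring

end
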